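/- arXiv:1302.2017 — 2 statements merged into one kernel-verified Lean document; each statement's English description precedes it below -/
import Mathlib

section
/- Under Assumptions 1 and 3 and with κ ∈ (0,1/2], for any pair (z^1, z^2) ∈ E_s with z^1 = (a^1, a^1) and z^2 = (a^2, a^2), the resistance χ(ρ) of the straight route ρ from z^1 to z^2 over the PHPIP chain {P^ε} is strictly smaller than 3/2, and χ(ρ) is minimal among the resistances of all paths of {P^ε} from z^1 to z^2. -/
open Filter Topology Set

attribute [local instance] Classical.propDecidable

section PHPIP

variable {ι : Type*} [Fintype ι] [DecidableEq ι] {A : ι → Type*} [∀ i, Fintype (A i)]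

/-- Assumption 1 on the constraint maps. -/
def Assumption1 (C : ∀ i, A i → Finset (A i)) : Prop :=
  (∀ (i : ι) (a b : A i), b ∈ C i a ↔ a ∈ C i b) ∧
  (∀ (i : ι) (a b : A i), ∃ (nf : ℕ) (f : ℕ → A i), f 0 = a ∧ f nf = b ∧
      ∀ k < nf, f (k + 1) ∈ C i (f k)) ∧
  (∀ (i : ι) (a : A i), 3 ≤ (C i a).card)

/-- Assumption 3: unilateral constrained deviations change the utility by less than 1/2. -/
def Assumption3 (U : ι → (∀ i, A i) → ℝ) (C : ∀ i, A i → Finset (A i)) : Prop :=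
  ∀ (i : ι) (a : ∀ j, A j) (b : A i), b ∈ C i (a i) →
    U i (Function.update a i b) - U i a < 1 / 2

/-- Γ is a constrained potential game with potential function φ. -/
def IsPotentialGame (U : ι → (∀ i, A i) → ℝ) (C : ∀ i, A i → Finset (A i))
    (φ : (∀ i, A i) → ℝ) : Prop :=
  ∀ (i : ι) (a : ∀ j, A j) (b : A i), b ∈ C i (a i) →
    U i (Function.update a i b) - U i a = φ (Function.update a i b) - φ a

/-- Probability that, from state `(a0, a1)`, player `i` selects the action `x`
under the PHPIP selection rule with exploration rate `ε` and parameter `κ`. -/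
noncomputable def selProb (κ : ℝ) (U : ι → (∀ i, A i) → ℝ)
    (C : ∀ i, A i → Finset (A i)) (ε : ℝ) (a0 a1 : ∀ i, A i) (i : ι) (x : A i) : ℝ :=
  if U i a0 ≤ U i a1 then
    (if x = a1 i then 1 - ε else 0) +
      (if x ∈ (C i (a1 i)).erase (a1 i) then
        ε / ((C i (a1 i)).erase (a1 i)).card else 0)
  else
    (if x = a1 i then (1 - ε) * (κ * ε ^ (U i a0 - U i a1)) else 0) +
      (if x = a0 i then (1 - ε) * (1 - κ * ε ^ (U i a0 - U i a1)) else 0) +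
      (if x ∈ ((C i (a1 i)).erase (a1 i)).erase (a0 i) then
        ε / (((C i (a1 i)).erase (a1 i)).erase (a0 i)).card else 0)

/-- One-step transition probability of the Markov chain `{P^ε}` induced by PHPIP
on pairs of joint actions. -/
noncomputable def phTrans (κ : ℝ) (U : ι → (∀ i, A i) → ℝ)
    (C : ∀ i, A i → Finset (A i)) (ε : ℝ)
    (z1 z2 : (∀ i, A i) × (∀ i, A i)) : ℝ :=
  if z2.1 = z1.2 then ∏ i, selProb κ U C ε z1.1 z1.2 i (z2.2 i) else 0

/-- The state space B. -/
def memB (C : ∀ i, A i → Finset (A i)) (z : (∀ i, A i) × (∀ i, A i)) : Prop :=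
  ∀ i, z.2 i ∈ C i (z.1 i)

/-- k-step transition probabilities of the homogeneous chain `{P^ε}`. -/
noncomputable def phTransPow (κ : ℝ) (U : ι → (∀ i, A i) → ℝ)
    (C : ∀ i, A i → Finset (A i)) (ε : ℝ) :
    ℕ → (∀ i, A i) × (∀ i, A i) → (∀ i, A i) × (∀ i, A i) → ℝ
  | 0, z, z' => if z = z' then 1 else 0
  | k + 1, z, z' => ∑ w : (∀ i, A i) × (∀ i, A i),
      phTrans κ U C ε z w * phTransPow κ U C ε k w z'

/-- Probability of a path (sequence of states) of the chain `{P^ε}`. -/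
noncomputable def pathProb (κ : ℝ) (U : ι → (∀ i, A i) → ℝ)
    (C : ∀ i, A i → Finset (A i)) (ε : ℝ) :
    List ((∀ i, A i) × (∀ i, A i)) → ℝ
  | [] => 1
  | [_] => 1
  | z :: z' :: rest => phTrans κ U C ε z z' * pathProb κ U C ε (z' :: rest)

/-- A transition is feasible if it has positive probability for some ε ∈ (0,1/2]. -/
def Feasible (κ : ℝ) (U : ι → (∀ i, A i) → ℝ) (C : ∀ i, A i → Finset (A i))
    (z z' : (∀ i, A i) × (∀ i, A i)) : Prop :=
  ∃ ε : ℝ, 0 < ε ∧ ε ≤ 1 / 2 ∧ 0 < phTrans κ U C ε z z'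

/-- `l` is a (feasible) path of the chain from `z1` to `z2`. -/
def IsPath (κ : ℝ) (U : ι → (∀ i, A i) → ℝ) (C : ∀ i, A i → Finset (A i))
    (z1 z2 : (∀ i, A i) × (∀ i, A i)) (l : List ((∀ i, A i) × (∀ i, A i))) : Prop :=
  l.head? = some z1 ∧ l.getLast? = some z2 ∧ l.Chain' (Feasible κ U C)

/-- `r` is the resistance of the path `l`:  `lim_{ε→0+} P^ε(l)/ε^r ∈ (0,∞)`. -/
def IsPathRes (κ : ℝ) (U : ι → (∀ i, A i) → ℝ) (C : ∀ i, A i → Finset (A i))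
    (l : List ((∀ i, A i) × (∀ i, A i))) (r : ℝ) : Prop :=
  ∃ L : ℝ, 0 < L ∧
    Tendsto (fun ε : ℝ => pathProb κ U C ε l / ε ^ r) (𝓝[>] (0 : ℝ)) (𝓝 L)

/-- `(a, b)` (as diagonal states `((a,a),(b,b))`) is a pair in `E_s`:
exactly one player deviates and the deviation is feasible. -/
def EsPair (C : ∀ i, A i → Finset (A i)) (a b : ∀ i, A i) : Prop :=
  (∃! i, a i ≠ b i) ∧ ∀ i, a i ≠ b i → b i ∈ C i (a i)

/-- The path (list of states) of the M-straight-route through the given diagonal nodes. -/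
def msrPath : List (∀ i, A i) → List ((∀ i, A i) × (∀ i, A i))
  | [] => []
  | [a] => [(a, a)]
  | a :: b :: rest => (a, a) :: (a, b) :: msrPath (b :: rest)

/-- Weight of the edge of the graph `G_R` from `z` to `z'`: the minimal resistance
among all paths of `{P^ε}` from `z` to `z'`. -/
noncomputable def edgeWeight (κ : ℝ) (U : ι → (∀ i, A i) → ℝ)
    (C : ∀ i, A i → Finset (A i)) (z z' : (∀ i, A i) × (∀ i, A i)) : ℝ :=
  sInf {r : ℝ | ∃ l, IsPath κ U C z z' l ∧ IsPathRes κ U C l r}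

/-- `y` is reachable from `x` in at most `d` constraint-feasible steps. -/
def ReachIn (C : ∀ i, A i → Finset (A i)) (i : ι) : ℕ → A i → A i → Prop
  | 0, x, y => x = y
  | d + 1, x, y => ReachIn C i d x y ∨ ∃ w, ReachIn C i d x w ∧ y ∈ C i w

/-- Inhomogeneous products: `transProd κ U C εs k0 m` is the transition matrix
`P(k0, k0 + m) = ∏_{k'=k0}^{k0+m-1} P_{k'}` of the PIPIP chain with exploration
rates `εs`. -/
noncomputable def transProd (κ : ℝ) (U : ι → (∀ i, A i) → ℝ)
    (C : ∀ i, A i → Finset (A i)) (εs : ℕ → ℝ) (k0 : ℕ) :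
    ℕ → (∀ i, A i) × (∀ i, A i) → (∀ i, A i) × (∀ i, A i) → ℝ
  | 0, z, z' => if z = z' then 1 else 0
  | m + 1, z, z' => ∑ w : (∀ i, A i) × (∀ i, A i),
      transProd κ U C εs k0 m z w * phTrans κ U C (εs (k0 + m)) w z'

/-- The PIPIP exploration rate `ε(k) = k^{-1/(n(D+1))}`. -/
noncomputable def pipipRate (n D : ℕ) (k : ℕ) : ℝ :=
  (k : ℝ) ^ (-(1 : ℝ) / ((n : ℝ) * ((D : ℝ) + 1)))

/-- Accessibility along the unperturbed chain `{P^0}`. -/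
def Accessible0 (κ : ℝ) (U : ι → (∀ i, A i) → ℝ) (C : ∀ i, A i → Finset (A i))
    (z z' : (∀ i, A i) × (∀ i, A i)) : Prop :=
  ∃ k : ℕ, 0 < phTransPow κ U C 0 k z z'

/-- A recurrent communication class of the unperturbed chain `{P^0}`. -/
def IsRecClass (κ : ℝ) (U : ι → (∀ i, A i) → ℝ) (C : ∀ i, A i → Finset (A i))
    (H : Set ((∀ i, A i) × (∀ i, A i))) : Prop :=
  H.Nonempty ∧ (∀ z ∈ H, ∀ z' ∈ H, Accessible0 κ U C z z') ∧
    (∀ z ∈ H, ∀ z', Accessible0 κ U C z z' → z' ∈ H)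

end PHPIP

section Resistance

/-- A function of order `ε ^ r` that dominates a multiple of `ε ^ R` satisfies `r ≤ R`. -/
theorem exponent_le_of_lower_bound {p : ℝ → ℝ} {r R L c : ℝ} (hc : 0 < c)
    (hp : Tendsto (fun ε : ℝ => p ε / ε ^ r) (𝓝[>] (0 : ℝ)) (𝓝 L))
    (hle : ∀ᶠ ε in 𝓝[>] (0 : ℝ), c * ε ^ R ≤ p ε) : r ≤ R := by
  by_contra! hlt
  have hpow : Tendsto (fun ε : ℝ => ε ^ (r - R)) (𝓝[>] (0 : ℝ)) (𝓝 0) := by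
    have := (Real.continuousAt_rpow_const 0 (r - R) (Or.inr (by linarith))).tendsto
    rw [Real.zero_rpow (by linarith)] at this
    exact this.mono_left nhdsWithin_le_nhds
  have hlim := hp.mul hpow
  rw [mul_zero] at hlim
  refine absurd (ge_of_tendsto hlim ?_) (not_le.mpr hc)
  filter_upwards [hle, self_mem_nhdsWithin] with ε hε hpos
  have hpos : (0 : ℝ) < ε := hpos
  have h1 : 0 < ε ^ r := Real.rpow_pos_of_pos hpos r
  have h2 : 0 < ε ^ R := Real.rpow_pos_of_pos hpos R
  rw [Real.rpow_sub hpos, div_mul_div_cancel₀ h1.ne', le_div_iff₀ h2]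
  exact hε

/-- A function of exact order `ε ^ r` dominated by `ε ^ R` satisfies `R ≤ r`. -/
theorem le_exponent_of_upper_bound {p : ℝ → ℝ} {r R L : ℝ} (hL : 0 < L)
    (hp : Tendsto (fun ε : ℝ => p ε / ε ^ r) (𝓝[>] (0 : ℝ)) (𝓝 L))
    (hle : ∀ᶠ ε in 𝓝[>] (0 : ℝ), p ε ≤ ε ^ R) : R ≤ r := by
  by_contra! hlt
  have hpow : Tendsto (fun ε : ℝ => ε ^ (R - r)) (𝓝[>] (0 : ℝ)) (𝓝 0) := by
    have := (Real.continuousAt_rpow_const 0 (R - r) (Or.inr (by linarith))).tendsto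
    rw [Real.zero_rpow (by linarith)] at this
    exact this.mono_left nhdsWithin_le_nhds
  refine absurd (le_of_tendsto_of_tendsto hp hpow ?_) (not_le.mpr hL)
  filter_upwards [hle, self_mem_nhdsWithin] with ε hε hpos
  have hpos : (0 : ℝ) < ε := hpos
  rw [Real.rpow_sub hpos]
  exact div_le_div_of_nonneg_right hε (Real.rpow_pos_of_pos hpos r).le

end Resistance

section Selection

variable {ι : Type*} {A : ι → Type*}
  {κ ε : ℝ} {U : ι → (∀ i, A i) → ℝ} {C : ∀ i, A i → Finset (A i)}

theorem div_natCast_le_self (hε : 0 ≤ ε) (n : ℕ) : ε / n ≤ ε := by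
  rcases Nat.eq_zero_or_pos n with rfl | hn
  · simpa using hε
  · exact div_le_self hε (by exact_mod_cast hn)

theorem selProb_nonneg (hκ0 : 0 < κ) (hκ : κ ≤ 1 / 2) (hε0 : 0 < ε) (hε : ε ≤ 1 / 2)
    (a b : ∀ i, A i) (i : ι) (x : A i) : 0 ≤ selProb κ U C ε a b i x := by
  have h1 : 0 ≤ 1 - ε := by linarith
  unfold selProb
  split_ifs with hU
  all_goals try positivity
  all_goals
    have hp : ε ^ (U i a - U i b) ≤ 1 :=
      Real.rpow_le_one hε0.le (by linarith) (by linarith)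
    have hp0 : 0 < ε ^ (U i a - U i b) := Real.rpow_pos_of_pos hε0 _
    have h2 : 0 ≤ 1 - κ * ε ^ (U i a - U i b) := by nlinarith
    positivity

theorem selProb_le_one (hκ0 : 0 < κ) (hκ : κ ≤ 1 / 2) (hε0 : 0 < ε) (hε : ε ≤ 1 / 2)
    (a b : ∀ i, A i) (i : ι) (x : A i) : selProb κ U C ε a b i x ≤ 1 := by
  unfold selProb
  by_cases hU : U i a ≤ U i b
  · have hq := div_natCast_le_self hε0.le ((C i (b i)).erase (b i)).card
    rw [if_pos hU]
    by_cases hx : x = b i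
    · subst hx
      simp
      linarith
    · rw [if_neg hx]
      split_ifs <;> linarith
  · rw [if_neg hU]
    have hq := div_natCast_le_self hε0.le (((C i (b i)).erase (b i)).erase (a i)).card
    have hp : ε ^ (U i a - U i b) ≤ 1 :=
      Real.rpow_le_one hε0.le (by linarith) (by linarith)
    have hp0 : 0 < ε ^ (U i a - U i b) := Real.rpow_pos_of_pos hε0 _
    have h2 : 0 < κ * ε ^ (U i a - U i b) := by positivity
    have h3 : κ * ε ^ (U i a - U i b) ≤ 1 := by nlinarith
    by_cases hxb : x = b i
    · rw [if_neg (c := x ∈ _) (by simp [hxb]), if_pos hxb]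
      split_ifs <;> nlinarith
    · by_cases hxa : x = a i
      · rw [if_neg (c := x ∈ _) (by simp [hxa]), if_neg hxb, if_pos hxa]
        nlinarith
      · rw [if_neg hxb, if_neg hxa]
        split_ifs <;> linarith

/-- Choosing an action that the selection rule does not prescribe costs a factor `ε`. -/
theorem selProb_le_of_explore (hε0 : 0 < ε) {a b : ∀ i, A i} {i : ι} {x : A i}
    (hxb : x ≠ b i) (hxa : x = a i → U i a ≤ U i b) : selProb κ U C ε a b i x ≤ ε := by
  unfold selProb
  have hq := fun n : ℕ => div_natCast_le_self hε0.le n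
  by_cases hU : U i a ≤ U i b
  · rw [if_pos hU, if_neg hxb]
    split_ifs <;> simp [hq, hε0.le]
  · rw [if_neg hU, if_neg hxb, if_neg fun h => hU (hxa h)]
    split_ifs <;> simp [hq, hε0.le]

/-- Keeping an action that differs from the previous one costs `ε` to the power of the
utility loss. -/
theorem selProb_keep_le (hκ0 : 0 < κ) (hκ : κ ≤ 1 / 2) (hε0 : 0 < ε) (hε : ε ≤ 1 / 2)
    {a b : ∀ i, A i} {i : ι} (hab : a i ≠ b i) :
    selProb κ U C ε a b i (b i) ≤ ε ^ max 0 (U i a - U i b) := by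
  by_cases hU : U i a ≤ U i b
  · rw [max_eq_left (by linarith), Real.rpow_zero]
    exact selProb_le_one hκ0 hκ hε0 hε a b i (b i)
  · rw [max_eq_right (by linarith)]
    have hp0 : 0 < ε ^ (U i a - U i b) := Real.rpow_pos_of_pos hε0 _
    have h2 : κ * ε ^ (U i a - U i b) ≤ ε ^ (U i a - U i b) := by nlinarith
    have h3 : 0 < κ * ε ^ (U i a - U i b) := by positivity
    simp only [selProb, if_neg hU, if_neg hab.symm]
    simp
    nlinarith

theorem le_selProb_keep (hκ0 : 0 < κ) (hκ : κ ≤ 1 / 2) (hε0 : 0 < ε) (hε : ε ≤ 1 / 2)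
    {a b : ∀ i, A i} {i : ι} (hab : a i ≠ b i) :
    κ / 2 * ε ^ max 0 (U i a - U i b) ≤ selProb κ U C ε a b i (b i) := by
  by_cases hU : U i a ≤ U i b
  · rw [max_eq_left (by linarith), Real.rpow_zero]
    simp [selProb, if_pos hU]
    linarith
  · rw [max_eq_right (by linarith)]
    have h3 : 0 < κ * ε ^ (U i a - U i b) := by positivity
    simp only [selProb, if_neg hU, if_neg hab.symm]
    simp
    nlinarith

theorem half_le_selProb_repeat (hε : ε ≤ 1 / 2) {a b : ∀ i, A i} {i : ι} (hab : a i = b i) :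
    1 / 2 ≤ selProb κ U C ε a b i (b i) := by
  by_cases hU : U i a ≤ U i b
  · simp [selProb, if_pos hU]
    linarith
  · simp only [selProb, if_neg hU, hab]
    simp
    linarith

theorem le_selProb_explore (a : ∀ i, A i) {i : ι} {x : A i} (hxa : x ≠ a i)
    (hx : x ∈ C i (a i)) :
    1 / ((C i (a i)).erase (a i)).card * ε ≤ selProb κ U C ε a a i x := by
  rw [selProb, if_pos le_rfl, if_neg hxa, if_pos (Finset.mem_erase.mpr ⟨hxa, hx⟩)]
  exact le_of_eq (by ring)

end Selection

section Transition

variable {ι : Type*} [Fintype ι] {A : ι → Type*}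
  {κ ε : ℝ} {U : ι → (∀ i, A i) → ℝ} {C : ∀ i, A i → Finset (A i)}

theorem phTrans_nonneg (hκ0 : 0 < κ) (hκ : κ ≤ 1 / 2) (hε0 : 0 < ε) (hε : ε ≤ 1 / 2)
    (z w : (∀ i, A i) × (∀ i, A i)) : 0 ≤ phTrans κ U C ε z w := by
  unfold phTrans
  split_ifs
  · exact Finset.prod_nonneg fun i _ => selProb_nonneg hκ0 hκ hε0 hε _ _ _ _
  · exact le_rfl

theorem phTrans_le_prod (hκ0 : 0 < κ) (hκ : κ ≤ 1 / 2) (hε0 : 0 < ε) (hε : ε ≤ 1 / 2)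
    (z w : (∀ i, A i) × (∀ i, A i)) (s : Finset ι) :
    phTrans κ U C ε z w ≤ ∏ i ∈ s, selProb κ U C ε z.1 z.2 i (w.2 i) := by
  have h0 := fun i => selProb_nonneg (U := U) (C := C) hκ0 hκ hε0 hε z.1 z.2 i (w.2 i)
  unfold phTrans
  split_ifs
  · exact Finset.prod_le_prod_of_subset_of_le_one (Finset.subset_univ s) (fun i _ => h0 i)
      fun i _ _ => selProb_le_one hκ0 hκ hε0 hε _ _ _ _
  · exact Finset.prod_nonneg fun i _ => h0 i

theorem phTrans_le_one (hκ0 : 0 < κ) (hκ : κ ≤ 1 / 2) (hε0 : 0 < ε) (hε : ε ≤ 1 / 2)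
    (z w : (∀ i, A i) × (∀ i, A i)) : phTrans κ U C ε z w ≤ 1 := by
  simpa using phTrans_le_prod (U := U) (C := C) hκ0 hκ hε0 hε z w ∅

theorem phTrans_le_selProb (hκ0 : 0 < κ) (hκ : κ ≤ 1 / 2) (hε0 : 0 < ε) (hε : ε ≤ 1 / 2)
    (z w : (∀ i, A i) × (∀ i, A i)) (i : ι) :
    phTrans κ U C ε z w ≤ selProb κ U C ε z.1 z.2 i (w.2 i) := by
  simpa using phTrans_le_prod (U := U) (C := C) hκ0 hκ hε0 hε z w {i}

/-- A transition with more than the probability of an exploration involves none: every player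
either repeats its last action or returns to the previous, strictly better one. -/
theorem eq_or_return_of_lt_phTrans (hκ0 : 0 < κ) (hκ : κ ≤ 1 / 2) (hε0 : 0 < ε)
    (hε : ε ≤ 1 / 2) {z w : (∀ i, A i) × (∀ i, A i)} (h : ε < phTrans κ U C ε z w) (i : ι) :
    w.2 i = z.2 i ∨ (w.2 i = z.1 i ∧ U i z.2 < U i z.1) := by
  by_contra! hne
  exact absurd (h.trans_le (phTrans_le_selProb hκ0 hκ hε0 hε z w i))
    (not_lt.mpr (selProb_le_of_explore hε0 hne.1 hne.2))

theorem fst_eq_of_phTrans_pos {z w : (∀ i, A i) × (∀ i, A i)}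
    (h : 0 < phTrans κ U C ε z w) : w.1 = z.2 := by
  by_contra hne
  simp [phTrans, hne] at h

/-- Two simultaneous explorations from a diagonal state cost a factor `ε * ε`. -/
theorem phTrans_diag_le_mul (hκ0 : 0 < κ) (hκ : κ ≤ 1 / 2) (hε0 : 0 < ε) (hε : ε ≤ 1 / 2)
    {a : ∀ i, A i} {w : (∀ i, A i) × (∀ i, A i)} {j k : ι} (hjk : j ≠ k)
    (hj : w.2 j ≠ a j) (hk : w.2 k ≠ a k) : phTrans κ U C ε (a, a) w ≤ ε * ε := by
  refine (phTrans_le_prod hκ0 hκ hε0 hε (a, a) w {j, k}).trans ?_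
  rw [Finset.prod_pair hjk]
  exact mul_le_mul (selProb_le_of_explore hε0 hj fun _ => le_rfl)
    (selProb_le_of_explore hε0 hk fun _ => le_rfl) (selProb_nonneg hκ0 hκ hε0 hε _ _ _ _) hε0.le

/-- Lower bound for a transition in which all players but `j` repeat their actions. -/
theorem le_phTrans_of_repeat (hκ0 : 0 < κ) (hκ : κ ≤ 1 / 2) (hε0 : 0 < ε) (hε : ε ≤ 1 / 2)
    {a b c : ∀ i, A i} {j : ι} {q : ℝ} (hab : ∀ i ≠ j, a i = b i) (hbc : ∀ i ≠ j, c i = b i)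
    (hq : q ≤ selProb κ U C ε a b j (c j)) :
    q * (1 / 2) ^ (Finset.univ.erase j).card ≤ phTrans κ U C ε (a, b) (b, c) := by
  simp only [phTrans, if_true]
  rw [← Finset.mul_prod_erase Finset.univ _ (Finset.mem_univ j)]
  refine mul_le_mul hq ?_ (by positivity) (selProb_nonneg hκ0 hκ hε0 hε _ _ _ _)
  rw [← Finset.prod_const]
  refine Finset.prod_le_prod (fun _ _ => by norm_num) fun i hi => ?_
  have hij := Finset.ne_of_mem_erase hi
  rw [hbc i hij]
  exact half_le_selProb_repeat hε (hab i hij)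

/-- A nonnegative function that no single transition can improve bounds path probabilities. -/
theorem pathProb_mul_le {h : (∀ i, A i) × (∀ i, A i) → ℝ}
    (hp : ∀ z w, 0 ≤ phTrans κ U C ε z w)
    (hstep : ∀ z w, phTrans κ U C ε z w * h w ≤ h z) :
    ∀ (l : List ((∀ i, A i) × (∀ i, A i))) (z w : (∀ i, A i) × (∀ i, A i)),
      l.head? = some z → l.getLast? = some w → pathProb κ U C ε l * h w ≤ h z
  | [], z, w, hz, _ => by simp at hz
  | [x], z, w, hz, hw => by
    simp only [List.head?_cons, Option.some.injEq, List.getLast?_singleton] at hz hw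
    subst hz
    subst hw
    simp [pathProb]
  | x :: y :: l, z, w, hz, hw => by
    simp only [List.head?_cons, Option.some.injEq] at hz
    subst hz
    rw [List.getLast?_cons_cons] at hw
    rw [pathProb, mul_assoc]
    exact (mul_le_mul_of_nonneg_left
      (pathProb_mul_le hp hstep (y :: l) y w rfl hw) (hp x y)).trans (hstep x y)

end Transition

section StraightRoute

variable {ι : Type*} {A : ι → Type*}
  {κ ε : ℝ} {U : ι → (∀ i, A i) → ℝ} {C : ∀ i, A i → Finset (A i)}

/-- The states that can be visited from `(a, a)` with a single exploration: diagonal states, a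
unilateral deviation from `a`, and the return from such a deviation that did not pay off. -/
def OneExploration (U : ι → (∀ i, A i) → ℝ) (a : ∀ i, A i)
    (z : (∀ i, A i) × (∀ i, A i)) : Prop :=
  z.1 = z.2 ∨ (z.1 = a ∧ ∃ j, ∀ i ≠ j, z.2 i = a i) ∨
    (z.2 = a ∧ ∃ j, (∀ i ≠ j, z.1 i = a i) ∧ U j z.1 ≤ U j a)

/-- Without exploration, a state within one exploration of `(a, a)` leads to another one. -/
theorem OneExploration.step {a : ∀ i, A i} {z w : (∀ i, A i) × (∀ i, A i)}
    (hz : OneExploration U a z) (hw : w.1 = z.2)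
    (hstep : ∀ i, w.2 i = z.2 i ∨ (w.2 i = z.1 i ∧ U i z.2 < U i z.1)) :
    OneExploration U a w := by
  obtain ⟨x, y⟩ := z
  obtain ⟨y', v⟩ := w
  simp only at hw hstep
  subst hw
  rcases hz with hd | ⟨hx, j, hj⟩ | ⟨hy, j, hj, hU⟩
  · simp only at hd
    subst hd
    exact Or.inl (funext fun i => ((hstep i).elim id And.left).symm)
  · simp only at hx hj
    subst hx
    have hv : ∀ i ≠ j, v i = x i := fun i hi =>
      (hstep i).elim (fun h => h.trans (hj i hi)) And.left
    rcases hstep j with h | ⟨h, hlt⟩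
    · refine Or.inl (funext fun i => ?_)
      by_cases hi : i = j
      · subst hi
        exact h.symm
      · exact (hj i hi).trans (hv i hi).symm
    · refine Or.inr (Or.inr ⟨funext fun i => ?_, j, hj, hlt.le⟩)
      by_cases hi : i = j
      · subst hi
        exact h
      · exact hv i hi
  · simp only at hy hj hU
    subst hy
    refine Or.inl (funext fun i => ?_)
    by_cases hi : i = j
    · subst hi
      exact ((hstep i).resolve_right fun h => absurd h.2 (not_lt.mpr hU)).symm
    · exact ((hstep i).elim id fun h => h.1.trans (hj i hi)).symm

/-- An upper bound for the probabilities of paths to `(b, b)`, where `δ` is the cost of keeping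
the deviation from `a` to `b`. -/
noncomputable def routeBound (U : ι → (∀ i, A i) → ℝ) (a b : ∀ i, A i) (ε δ : ℝ)
    (z : (∀ i, A i) × (∀ i, A i)) : ℝ :=
  if z = (a, a) then ε * δ
  else if z ≠ (b, b) ∧ OneExploration U a z then δ
  else 1

variable [Fintype ι]

theorem phTrans_mul_routeBound_le (hκ0 : 0 < κ) (hκ : κ ≤ 1 / 2) (hε0 : 0 < ε)
    (hε : ε ≤ 1 / 2) {a b : ∀ i, A i} {j : ι} (hj : a j ≠ b j)
    (hU : U j a - U j b ≤ 1) (z w : (∀ i, A i) × (∀ i, A i)) :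
    phTrans κ U C ε z w * routeBound U a b ε (ε ^ max 0 (U j a - U j b)) w ≤
      routeBound U a b ε (ε ^ max 0 (U j a - U j b)) z := by
  have hε1 : ε ≤ 1 := by linarith
  have hkeep : ∀ w : (∀ i, A i) × (∀ i, A i), w = (b, b) →
      phTrans κ U C ε (a, b) w ≤ ε ^ max 0 (U j a - U j b) := by
    rintro _ rfl
    exact (phTrans_le_selProb hκ0 hκ hε0 hε (a, b) (b, b) j).trans
      (selProb_keep_le hκ0 hκ hε0 hε hj)
  have hδ0 : 0 < ε ^ max 0 (U j a - U j b) := Real.rpow_pos_of_pos hε0 _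
  have hδ1 : ε ^ max 0 (U j a - U j b) ≤ 1 :=
    Real.rpow_le_one hε0.le hε1 (le_max_left _ _)
  have hεδ : ε ≤ ε ^ max 0 (U j a - U j b) := by
    simpa using Real.rpow_le_rpow_of_exponent_ge hε0 hε1 (max_le zero_le_one hU)
  generalize ε ^ max 0 (U j a - U j b) = δ at *
  have hp0 : 0 ≤ phTrans κ U C ε z w := phTrans_nonneg hκ0 hκ hε0 hε z w
  have hp1 : phTrans κ U C ε z w ≤ 1 := phTrans_le_one hκ0 hκ hε0 hε z w
  have hab : a ≠ b := fun h => hj (congrFun h j)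
  have hδδ : ε * δ ≤ δ := mul_le_of_le_one_left hδ0.le hε1
  have hone : ∀ w, 0 ≤ routeBound U a b ε δ w ∧ routeBound U a b ε δ w ≤ 1 := fun w => by
    unfold routeBound
    split_ifs
    · exact ⟨by positivity, hδδ.trans hδ1⟩
    · exact ⟨hδ0.le, hδ1⟩
    · simp
  have hnear : ∀ w, w ≠ (b, b) → OneExploration U a w → routeBound U a b ε δ w ≤ δ :=
    fun w hw hS => by
      unfold routeBound
      split_ifs with h1 h2
      · exact hδδ
      · exact le_rfl
      · exact absurd ⟨hw, hS⟩ h2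
  rcases hp0.eq_or_lt with hp | hp
  · rw [← hp, zero_mul]
    exact (hone z).1
  have hwz := fst_eq_of_phTrans_pos hp
  by_cases hza : z = (a, a)
  · subst hza
    have hwb : w ≠ (b, b) := by
      rintro rfl
      exact hab hwz.symm
    rw [show routeBound U a b ε δ (a, a) = ε * δ by simp [routeBound]]
    by_cases hwa : w.2 = a
    · have : w = (a, a) := Prod.ext hwz hwa
      subst this
      rw [show routeBound U a b ε δ (a, a) = ε * δ by simp [routeBound]]
      exact mul_le_of_le_one_left (by positivity) hp1
    · obtain ⟨k, hk⟩ := Function.ne_iff.mp hwa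
      by_cases huniq : ∀ i ≠ k, w.2 i = a i
      · exact mul_le_mul ((phTrans_le_selProb hκ0 hκ hε0 hε (a, a) w k).trans
          (selProb_le_of_explore hε0 hk fun _ => le_rfl))
          (hnear w hwb (Or.inr (Or.inl ⟨hwz, k, huniq⟩))) (hone w).1 hε0.le
      · push Not at huniq
        obtain ⟨m, hmk, hm⟩ := huniq
        calc phTrans κ U C ε (a, a) w * routeBound U a b ε δ w
            ≤ phTrans κ U C ε (a, a) w := mul_le_of_le_one_right hp0 (hone w).2
          _ ≤ ε * ε := phTrans_diag_le_mul hκ0 hκ hε0 hε hmk hm hk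
          _ ≤ ε * δ := mul_le_mul_of_nonneg_left hεδ hε0.le
  by_cases hS : z ≠ (b, b) ∧ OneExploration U a z
  · rw [show routeBound U a b ε δ z = δ by simp [routeBound, hza, hS.1, hS.2]]
    by_cases hpε : phTrans κ U C ε z w ≤ ε
    · exact (mul_le_of_le_one_right hp0 (hone w).2).trans (hpε.trans hεδ)
    have hstep := eq_or_return_of_lt_phTrans hκ0 hκ hε0 hε (not_le.mp hpε)
    by_cases hwb : w = (b, b)
    · have hz2 : z.2 = b := by rw [← hwz, hwb]
      have hz1 : z.1 = a := by
        rcases hS.2 with h | h | h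
        · exact absurd (Prod.ext (h.trans hz2) hz2) hS.1
        · exact h.1
        · exact absurd (h.1.symm.trans hz2) hab
      have hz : z = (a, b) := Prod.ext hz1 hz2
      subst hz
      exact (mul_le_of_le_one_right hp0 (hone w).2).trans (hkeep w hwb)
    · exact (mul_le_of_le_one_left (hone w).1 hp1).trans
        (hnear w hwb (hS.2.step hwz hstep))
  · rw [show routeBound U a b ε δ z = 1 by rw [routeBound, if_neg hza, if_neg hS]]
    exact mul_le_one₀ hp1 (hone w).1 (hone w).2

/-- Every path from `(a, a)` to `(b, b)` has probability of order at most that of the straight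
route of a player `j` on whose action `a` and `b` differ. -/
theorem pathProb_le_rpow (hκ0 : 0 < κ) (hκ : κ ≤ 1 / 2) (hε0 : 0 < ε)
    (hε : ε ≤ 1 / 2) {a b : ∀ i, A i} {j : ι} (hj : a j ≠ b j) (hU : U j a - U j b ≤ 1)
    {l : List ((∀ i, A i) × (∀ i, A i))} (hl : IsPath κ U C (a, a) (b, b) l) :
    pathProb κ U C ε l ≤ ε ^ (1 + max 0 (U j a - U j b)) := by
  have hab : b ≠ a := fun h => hj (congrFun h.symm j)
  have h := pathProb_mul_le (phTrans_nonneg hκ0 hκ hε0 hε)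
    (phTrans_mul_routeBound_le (C := C) hκ0 hκ hε0 hε hj hU) l (a, a) (b, b) hl.1 hl.2.1
  rw [Real.rpow_add hε0, Real.rpow_one]
  simpa [routeBound, hab] using h

theorem le_pathProb_straight (hκ0 : 0 < κ) (hκ : κ ≤ 1 / 2) (hε0 : 0 < ε)
    (hε : ε ≤ 1 / 2) {a b : ∀ i, A i} {j : ι} (hj : a j ≠ b j) (hC : b j ∈ C j (a j))
    (hne : ∀ i ≠ j, a i = b i) :
    1 / ((C j (a j)).erase (a j)).card * (1 / 2) ^ (Finset.univ.erase j).card *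
        (κ / 2 * (1 / 2) ^ (Finset.univ.erase j).card) * ε ^ (1 + max 0 (U j a - U j b)) ≤
      pathProb κ U C ε [(a, a), (a, b), (b, b)] := by
  have h1 := le_phTrans_of_repeat hκ0 hκ hε0 hε (fun _ _ => rfl) (fun i hi => (hne i hi).symm)
    (le_selProb_explore (κ := κ) (ε := ε) (U := U) a hj.symm hC)
  have h2 := le_phTrans_of_repeat hκ0 hκ hε0 hε hne (fun _ _ => rfl)
    (le_selProb_keep (U := U) (C := C) hκ0 hκ hε0 hε hj)
  have h3 : 0 < ε ^ max 0 (U j a - U j b) := Real.rpow_pos_of_pos hε0 _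
  have h := mul_le_mul h1 h2 (by positivity) (phTrans_nonneg hκ0 hκ hε0 hε _ _)
  rw [Real.rpow_add hε0, Real.rpow_one]
  simp only [pathProb, mul_one]
  refine le_trans (le_of_eq ?_) h
  ring

end StraightRoute

section Theorems

variable {ι : Type*} [Fintype ι] [DecidableEq ι] {A : ι → Type*} [∀ i, Fintype (A i)]

theorem statement8
    (U : ι → (∀ i, A i) → ℝ) (C : ∀ i, A i → Finset (A i))
    (κ : ℝ) (hκ0 : 0 < κ) (hκ : κ ≤ 1 / 2)
    (hA1 : Assumption1 C) (hA3 : Assumption3 U C)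
    (a1 a2 : ∀ i, A i) (hEs : EsPair C a1 a2)
    (r : ℝ) (hr : IsPathRes κ U C [(a1, a1), (a1, a2), (a2, a2)] r) :
    r < 3 / 2 ∧ ∀ (l : List ((∀ i, A i) × (∀ i, A i))) (r' : ℝ),
      IsPath κ U C (a1, a1) (a2, a2) l → IsPathRes κ U C l r' → r ≤ r' := by

  obtain ⟨⟨j, hj, huniq⟩, hC⟩ := hEs
  have hne : ∀ i ≠ j, a1 i = a2 i := fun i hi => by
    by_contra h
    exact hi (huniq i h)
  have hU : U j a1 - U j a2 < 1 / 2 := by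
    have hupd : Function.update a2 j (a1 j) = a1 := by
      rw [Function.update_eq_iff]
      exact ⟨rfl, fun i hi => (hne i hi).symm⟩
    have := hA3 j a2 (a1 j) ((hA1.1 j _ _).mp (hC j hj))
    rwa [hupd] at this
  have hsmall : ∀ᶠ ε in 𝓝[>] (0 : ℝ), 0 < ε ∧ ε ≤ 1 / 2 := by
    filter_upwards [Ioc_mem_nhdsGT (show (0 : ℝ) < 1 / 2 by norm_num)] with ε hε using hε
  have hcard : 0 < ((C j (a1 j)).erase (a1 j)).card :=
    Finset.card_pos.mpr ⟨a2 j, Finset.mem_erase.mpr ⟨Ne.symm hj, hC j hj⟩⟩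
  obtain ⟨L, -, hL⟩ := hr
  have hrle : r ≤ 1 + max 0 (U j a1 - U j a2) :=
    exponent_le_of_lower_bound (by positivity) hL
      (hsmall.mono fun ε hε => le_pathProb_straight hκ0 hκ hε.1 hε.2 hj (hC j hj) hne)
  refine ⟨hrle.trans_lt ?_, fun l r' hl hr' => hrle.trans ?_⟩
  · have : max 0 (U j a1 - U j a2) < 1 / 2 := max_lt (by norm_num) hU
    linarith
  · obtain ⟨L', hL'0, hL'⟩ := hr'
    exact le_exponent_of_upper_bound hL'0 hL'
      (hsmall.mono fun ε hε => pathProb_le_rpow hκ0 hκ hε.1 hε.2 hj (by linarith) hl)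

end Theorems
end

section
/- Under Assumptions 1 and 3 and with κ ∈ (0,1/2], let Γ be a constrained potential game with potential φ, let ρ be an M-straight-route of the PHPIP chain from z^1 = (a^1, a^1) to z^2 = (a^2, a^2) through the diag(A)-nodes z^{(1)} = z^1, z^{(2)}, …, z^{(M)} = z^2, and let ρ' be the reverse M-straight-route from z^2 to z^1 through the same nodes in reverse order. If φ(a^1) > φ(a^2), then χ(ρ) > χ(ρ'). -/
open Filter Topology Set

attribute [local instance] Classical.propDecidable

/-- `f ε` is of exact order `ε ^ r` as `ε → 0⁺`. -/
def HasOrder (f : ℝ → ℝ) (r : ℝ) : Prop :=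
  ∃ L : ℝ, 0 < L ∧ Tendsto (fun ε : ℝ => f ε / ε ^ r) (𝓝[>] (0 : ℝ)) (𝓝 L)

namespace HasOrder

theorem congr' {f g : ℝ → ℝ} {r : ℝ} (hf : HasOrder f r) (h : ∀ ε, 0 < ε → f ε = g ε) :
    HasOrder g r := by
  obtain ⟨L, hL, hlim⟩ := hf
  refine ⟨L, hL, hlim.congr' ?_⟩
  filter_upwards [self_mem_nhdsWithin] with ε hε
  rw [h ε hε]

theorem const {c : ℝ} (hc : 0 < c) : HasOrder (fun _ => c) 0 :=
  ⟨c, hc, by simp⟩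

theorem rpow (r : ℝ) : HasOrder (fun ε => ε ^ r) r := by
  refine ⟨1, one_pos, tendsto_const_nhds.congr' ?_⟩
  filter_upwards [self_mem_nhdsWithin] with ε hε
  exact (div_self (Real.rpow_pos_of_pos hε r).ne').symm

theorem one_sub : HasOrder (fun ε => 1 - ε) 0 := by
  refine ⟨1, one_pos, ?_⟩
  have h : Tendsto (fun ε : ℝ => 1 - ε) (𝓝 0) (𝓝 (1 - 0)) :=
    (continuous_const.sub continuous_id).tendsto 0
  simpa using h.mono_left nhdsWithin_le_nhds

theorem mul {f g : ℝ → ℝ} {r s : ℝ} (hf : HasOrder f r) (hg : HasOrder g s) :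
    HasOrder (fun ε => f ε * g ε) (r + s) := by
  obtain ⟨L, hL, hf⟩ := hf
  obtain ⟨M, hM, hg⟩ := hg
  refine ⟨L * M, mul_pos hL hM, (hf.mul hg).congr' ?_⟩
  filter_upwards [self_mem_nhdsWithin] with ε hε
  rw [Real.rpow_add hε, div_mul_div_comm]

theorem prod {ι : Type*} (s : Finset ι) {f : ι → ℝ → ℝ} {r : ι → ℝ}
    (h : ∀ i ∈ s, HasOrder (f i) (r i)) :
    HasOrder (fun ε => ∏ i ∈ s, f i ε) (∑ i ∈ s, r i) := by
  induction s using Finset.induction_on with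
  | empty => simpa using const one_pos
  | insert i s hi ih =>
    simp only [Finset.prod_insert hi, Finset.sum_insert hi]
    exact (h i (Finset.mem_insert_self i s)).mul
      (ih fun j hj => h j (Finset.mem_insert_of_mem hj))

theorem not_lt {f : ℝ → ℝ} {r s : ℝ} (hr : HasOrder f r) (hs : HasOrder f s) : ¬ r < s := by
  intro hlt
  obtain ⟨L, hL, hr⟩ := hr
  obtain ⟨M, -, hs⟩ := hs
  have hzero : Tendsto (fun ε : ℝ => ε ^ (s - r)) (𝓝[>] 0) (𝓝 0) := by
    have h := (Real.continuousAt_rpow_const 0 (s - r) (Or.inr (sub_pos.2 hlt).le)).tendsto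
    rw [Real.zero_rpow (sub_pos.2 hlt).ne'] at h
    exact h.mono_left nhdsWithin_le_nhds
  have hlim : Tendsto (fun ε : ℝ => f ε / ε ^ r) (𝓝[>] 0) (𝓝 (M * 0)) := by
    refine (hs.mul hzero).congr' ?_
    filter_upwards [self_mem_nhdsWithin] with ε hε
    have h1 := (Real.rpow_pos_of_pos hε r).ne'
    have h2 := (Real.rpow_pos_of_pos hε s).ne'
    rw [Real.rpow_sub hε]
    field_simp
  exact hL.ne' (by simpa using tendsto_nhds_unique hr hlim)

theorem unique {f : ℝ → ℝ} {r s : ℝ} (hr : HasOrder f r) (hs : HasOrder f s) : r = s :=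
  le_antisymm (_root_.not_lt.1 (hs.not_lt hr)) (_root_.not_lt.1 (hr.not_lt hs))

end HasOrder

section StraightRoute

/-- Resistance of the straight routes through a list of joint actions, in terms of the potential. -/
noncomputable def routeRes {S : Type*} (φ : S → ℝ) : List S → ℝ
  | [] => 0
  | [_] => 0
  | a :: b :: rest => 1 + max 0 (φ a - φ b) + routeRes φ (b :: rest)

theorem routeRes_append_pair {S : Type*} (φ : S → ℝ) (l : List S) (a b : S) :
    routeRes φ (l ++ [a, b]) = routeRes φ (l ++ [a]) + (1 + max 0 (φ a - φ b)) := by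
  induction l with
  | nil => simp [routeRes]
  | cons x l ih =>
    cases l with
    | nil => simp [routeRes]
    | cons y l =>
      simp only [List.cons_append, routeRes] at ih ⊢
      rw [ih]
      ring

theorem routeRes_sub_routeRes_reverse {S : Type*} (φ : S → ℝ) (l : List S) (a b : S)
    (hhead : l.head? = some a) (hlast : l.getLast? = some b) :
    routeRes φ l - routeRes φ l.reverse = φ a - φ b := by
  induction l generalizing a with
  | nil => simp at hhead
  | cons x l ih =>
    obtain rfl : x = a := by simpa using hhead
    cases l with
    | nil =>
      obtain rfl : x = b := by simpa using hlast
      simp [routeRes]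
    | cons y l =>
      have h := ih y rfl (by simpa using hlast)
      have happ := routeRes_append_pair φ l.reverse y x
      have hmax : max 0 (φ x - φ y) - max 0 (φ y - φ x) = φ x - φ y := by
        rcases le_total (φ x) (φ y) with hle | hle
        · rw [max_eq_left (by linarith), max_eq_right (by linarith)]
          ring
        · rw [max_eq_right (by linarith), max_eq_left (by linarith)]
          ring
      simp only [List.reverse_cons, List.append_assoc, List.cons_append, List.nil_append] at h ⊢
      rw [happ]
      simp only [routeRes]
      linarith

variable {ι : Type*} {A : ι → Type*}

theorem EsPair.symm {C : ∀ i, A i → Finset (A i)}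
    (hC : ∀ (i : ι) (a b : A i), b ∈ C i a ↔ a ∈ C i b) {a b : ∀ i, A i}
    (h : EsPair C a b) : EsPair C b a := by
  refine ⟨?_, fun i hi => (hC i _ _).1 (h.2 i hi.symm)⟩
  simpa only [ne_comm] using h.1

theorem IsPotentialGame.sub_eq_of_esPair [DecidableEq ι] {U : ι → (∀ i, A i) → ℝ}
    {C : ∀ i, A i → Finset (A i)} {φ : (∀ i, A i) → ℝ} (hpot : IsPotentialGame U C φ)
    {a b : ∀ i, A i} (h : EsPair C a b) {i : ι} (hi : a i ≠ b i) :
    U i a - U i b = φ a - φ b := by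
  have hb : Function.update a i (b i) = b := by
    funext j
    by_cases hj : j = i
    · subst hj
      simp
    · rw [Function.update_of_ne hj]
      by_contra hne
      exact hj (h.1.unique hne hi)
  have := hpot i a (b i) (h.2 i hi)
  rw [hb] at this
  linarith

theorem selProb_of_eq (κ : ℝ) (U : ι → (∀ i, A i) → ℝ) (C : ∀ i, A i → Finset (A i)) (ε : ℝ)
    {a b : ∀ i, A i} {i : ι} (hi : a i = b i) : selProb κ U C ε a b i (b i) = 1 - ε := by
  unfold selProb
  split_ifs <;> simp_all
  ring

theorem hasOrder_selProb_explore (κ : ℝ) (U : ι → (∀ i, A i) → ℝ)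
    (C : ∀ i, A i → Finset (A i)) {a b : ∀ i, A i} {i : ι} (hi : a i ≠ b i)
    (hb : b i ∈ C i (a i)) : HasOrder (fun ε => selProb κ U C ε a a i (b i)) 1 := by
  have hmem : b i ∈ (C i (a i)).erase (a i) := Finset.mem_erase.2 ⟨hi.symm, hb⟩
  have hcard : (0 : ℝ) < ((C i (a i)).erase (a i)).card :=
    Nat.cast_pos.2 (Finset.card_pos.2 ⟨_, hmem⟩)
  have h := (HasOrder.rpow 1).mul (HasOrder.const (inv_pos.2 hcard))
  rw [add_zero] at h
  refine h.congr' fun ε _ => ?_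
  rw [selProb, if_pos le_rfl, if_neg hi.symm, if_pos hmem, Real.rpow_one, zero_add, div_eq_mul_inv]

theorem hasOrder_selProb_repeat {κ : ℝ} (hκ : 0 < κ) (U : ι → (∀ i, A i) → ℝ)
    (C : ∀ i, A i → Finset (A i)) {a b : ∀ i, A i} {i : ι} (hi : a i ≠ b i) :
    HasOrder (fun ε => selProb κ U C ε a b i (b i)) (max 0 (U i a - U i b)) := by
  by_cases hU : U i a ≤ U i b
  · rw [max_eq_left (by linarith)]
    refine HasOrder.one_sub.congr' fun ε _ => ?_
    simp [selProb, hU]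
  · rw [max_eq_right (by linarith)]
    have h := HasOrder.one_sub.mul ((HasOrder.const hκ).mul (HasOrder.rpow (U i a - U i b)))
    rw [zero_add, zero_add] at h
    refine h.congr' fun ε _ => ?_
    simp [selProb, hU, hi.symm]

theorem hasOrder_prod_selProb [Fintype ι] (κ : ℝ) (U : ι → (∀ i, A i) → ℝ) (C : ∀ i, A i → Finset (A i))
    {a b c : ∀ i, A i} {i : ι} {r : ℝ}
    (hi : HasOrder (fun ε => selProb κ U C ε a c i (b i)) r)
    (hne : ∀ j ≠ i, a j = b j ∧ c j = b j) :
    HasOrder (fun ε => ∏ j, selProb κ U C ε a c j (b j)) r := by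
  have h := HasOrder.prod Finset.univ (f := fun j ε => selProb κ U C ε a c j (b j))
    (r := fun j => if j = i then r else 0) (fun j _ => by
      by_cases hj : j = i
      · subst hj
        simpa using hi
      · rw [if_neg hj]
        refine HasOrder.one_sub.congr' fun ε _ => ?_
        obtain ⟨h1, h2⟩ := hne j hj
        rw [← selProb_of_eq κ U C ε (h1.trans h2.symm), h2])
  simpa using h

theorem hasOrder_straightRoute [Fintype ι] [DecidableEq ι] {κ : ℝ} (hκ : 0 < κ)
    {U : ι → (∀ i, A i) → ℝ}
    {C : ∀ i, A i → Finset (A i)} {φ : (∀ i, A i) → ℝ} (hpot : IsPotentialGame U C φ)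
    {a b : ∀ i, A i} (h : EsPair C a b) :
    HasOrder (fun ε => phTrans κ U C ε (a, a) (a, b) * phTrans κ U C ε (a, b) (b, b))
      (1 + max 0 (φ a - φ b)) := by
  obtain ⟨i, hi, huniq⟩ := h.1
  have heq : ∀ j ≠ i, a j = b j := fun j hj => by
    by_contra hne
    exact hj (huniq j hne)
  rw [← hpot.sub_eq_of_esPair h hi]
  simp only [phTrans, if_true]
  exact (hasOrder_prod_selProb κ U C (hasOrder_selProb_explore κ U C hi (h.2 i hi))
      fun j hj => ⟨heq j hj, heq j hj⟩).mul
    (hasOrder_prod_selProb κ U C (hasOrder_selProb_repeat hκ U C hi)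
      fun j hj => ⟨heq j hj, rfl⟩)

theorem pathProb_msrPath_cons_cons [Fintype ι] (κ : ℝ) (U : ι → (∀ i, A i) → ℝ)
    (C : ∀ i, A i → Finset (A i)) (ε : ℝ) (a b : ∀ i, A i) (l : List (∀ i, A i)) :
    pathProb κ U C ε (msrPath (a :: b :: l)) =
      phTrans κ U C ε (a, a) (a, b) * phTrans κ U C ε (a, b) (b, b) *
        pathProb κ U C ε (msrPath (b :: l)) := by
  cases l <;> simp [msrPath, pathProb, mul_assoc]

theorem hasOrder_pathProb_msrPath [Fintype ι] [DecidableEq ι] {κ : ℝ} (hκ : 0 < κ)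
    {U : ι → (∀ i, A i) → ℝ}
    {C : ∀ i, A i → Finset (A i)} {φ : (∀ i, A i) → ℝ} (hpot : IsPotentialGame U C φ)
    (l : List (∀ i, A i)) (hl : l.IsChain (EsPair C)) :
    HasOrder (fun ε => pathProb κ U C ε (msrPath l)) (routeRes φ l) := by
  induction l with
  | nil => simpa [msrPath, pathProb, routeRes] using HasOrder.const one_pos
  | cons a l ih =>
    cases l with
    | nil => simpa [msrPath, pathProb, routeRes] using HasOrder.const one_pos
    | cons b l =>
      rw [List.isChain_cons_cons] at hl
      simp only [pathProb_msrPath_cons_cons, routeRes]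
      exact (hasOrder_straightRoute hκ hpot hl.1).mul (ih hl.2)

end StraightRoute

section Theorems

variable {ι : Type*} [Fintype ι] [DecidableEq ι] {A : ι → Type*} [∀ i, Fintype (A i)]

theorem statement10
    (U : ι → (∀ i, A i) → ℝ) (C : ∀ i, A i → Finset (A i)) (φ : (∀ i, A i) → ℝ)
    (κ : ℝ) (hκ0 : 0 < κ) (hκ : κ ≤ 1 / 2)
    (hA1 : Assumption1 C) (hA3 : Assumption3 U C) (hpot : IsPotentialGame U C φ)
    (nodes : List (∀ i, A i)) (a1 a2 : ∀ i, A i)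
    (hhead : nodes.head? = some a1) (hlast : nodes.getLast? = some a2)
    (hnodup : nodes.Nodup) (hchain : nodes.Chain' (EsPair C))
    (hφ : φ a2 < φ a1)
    (r r' : ℝ) (hr : IsPathRes κ U C (msrPath nodes) r)
    (hr' : IsPathRes κ U C (msrPath nodes.reverse) r') :
    r' < r := by
  have hrev : nodes.reverse.IsChain (EsPair C) :=
    List.isChain_reverse.2 (List.IsChain.imp (fun _ _ h => EsPair.symm hA1.1 h) hchain)
  have h1 : r = routeRes φ nodes :=
    HasOrder.unique hr (hasOrder_pathProb_msrPath hκ0 hpot nodes hchain)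
  have h2 : r' = routeRes φ nodes.reverse :=
    HasOrder.unique hr' (hasOrder_pathProb_msrPath hκ0 hpot nodes.reverse hrev)
  have h3 := routeRes_sub_routeRes_reverse φ nodes a1 a2 hhead hlast
  linarith

end Theorems
end
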